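/- Let s > 1/2. The trilinear operator T_Φ defined on the Fourier side by F[T_Φ(v₁,v₂,v₃)](ξ) = ∫_{ξ=ξ₁-ξ₂+ξ₃} (|ξ₂|/⟨Φ(ξ̄)⟩^{1/2}) v̂₁(ξ₁) conj(v̂₂(ξ₂)) v̂₃(ξ₃) dξ₁ dξ₂ satisfies ‖T_Φ(v₁,v₂,v₃)‖_{H^s(ℝ)} ≤ C(s) ∏_{j=1}^3 ‖v_j‖_{H^s(ℝ)}. -/

import Mathlib

open MeasureTheory FourierTransform Complex

/-- The Japanese bracket `⟨x⟩ = (1+x²)^{1/2}`. -/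
noncomputable def jb (x : ℝ) : ℝ := (1 + x ^ 2) ^ ((1 : ℝ) / 2)

/-- The Sobolev `H^s(ℝ)` norm, defined on the Fourier side. -/
noncomputable def sobolevNorm (s : ℝ) (f : ℝ → ℂ) : ℝ :=
  (∫ ξ : ℝ, jb ξ ^ (2 * s) * ‖𝓕 f ξ‖ ^ 2) ^ ((1 : ℝ) / 2)

/-- Membership in the Sobolev space `H^s(ℝ)`. -/
def memHs (s : ℝ) (f : ℝ → ℂ) : Prop :=
  Integrable (fun ξ : ℝ => jb ξ ^ (2 * s) * ‖𝓕 f ξ‖ ^ 2)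

/-- The modulation function `Φ(ξ̄) = ξ² - ξ₁² + ξ₂² - ξ₃²`. -/
def modPhi (ξ ξ₁ ξ₂ ξ₃ : ℝ) : ℝ := ξ ^ 2 - ξ₁ ^ 2 + ξ₂ ^ 2 - ξ₃ ^ 2

/-- The trilinear operator `T_Φ`, defined on the Fourier side by
`F[T_Φ(v₁,v₂,v₃)](ξ) = ∫_{ξ=ξ₁-ξ₂+ξ₃} (|ξ₂|/⟨Φ(ξ̄)⟩^{1/2}) v̂₁(ξ₁) conj(v̂₂(ξ₂)) v̂₃(ξ₃)`,
with `ξ₃ = ξ - ξ₁ + ξ₂`. -/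
noncomputable def TPhi (v₁ v₂ v₃ : ℝ → ℂ) : ℝ → ℂ :=
  𝓕⁻ fun ξ : ℝ => ∫ ξ₁ : ℝ, ∫ ξ₂ : ℝ,
    ((|ξ₂| / jb (modPhi ξ ξ₁ ξ₂ (ξ - ξ₁ + ξ₂)) ^ ((1 : ℝ) / 2) : ℝ) : ℂ) *
      𝓕 v₁ ξ₁ * (starRingEnd ℂ) (𝓕 v₂ ξ₂) * 𝓕 v₃ (ξ - ξ₁ + ξ₂)

theorem Real.continuous_fourier_of_integrable {f : ℝ → ℂ} (hf : Integrable f) :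
    Continuous (𝓕 f) :=
  VectorFourier.fourierIntegral_continuous Real.continuous_fourierChar
    (L := innerₗ ℝ) continuous_inner hf

theorem Real.fourier_eq_zero_of_not_integrable {f : ℝ → ℂ} (hf : ¬ Integrable f) :
    𝓕 f = 0 := by
  ext w
  rw [Real.fourier_eq]
  exact integral_undef fun h => hf ((Real.fourierIntegral_convergent_iff w).1 h)

theorem Real.measurable_fourier (f : ℝ → ℂ) : Measurable (𝓕 f) := by
  by_cases hf : Integrable f
  · exact (Real.continuous_fourier_of_integrable hf).measurable
  · rw [Real.fourier_eq_zero_of_not_integrable hf]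
    exact measurable_zero

theorem Real.integral_fourier_mul_eq_of_integrable {f g : ℝ → ℂ}
    (hf : Integrable f) (hg : Integrable g) :
    ∫ ξ, 𝓕 f ξ * g ξ = ∫ x, f x * 𝓕 g x := by
  simpa using! VectorFourier.integral_bilin_fourierIntegral_eq_flip
    (ContinuousLinearMap.mul ℂ ℂ) (L := innerₗ ℝ)
    Real.continuous_fourierChar continuous_inner hf hg

theorem Real.integral_fourierInv_mul_eq_of_integrable {f g : ℝ → ℂ}
    (hf : Integrable f) (hg : Integrable g) :
    ∫ ξ, 𝓕⁻ f ξ * g ξ = ∫ x, f x * 𝓕⁻ g x := by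
  rw [Real.fourierInv_eq_fourier_comp_neg f,
    Real.integral_fourier_mul_eq_of_integrable hf.comp_neg hg,
    ← integral_neg_eq_self]
  simp [Real.fourierInv_eq_fourier_neg]

/-- Fourier inversion almost everywhere, without any continuity assumption. -/
theorem Real.fourier_fourierInv_ae_eq {g : ℝ → ℂ} (hg : Integrable g)
    (hg' : Integrable (𝓕⁻ g)) : ∀ᵐ ξ, 𝓕 (𝓕⁻ g) ξ = g ξ := by
  refine ae_eq_of_integral_contDiff_smul_eq
    (Real.continuous_fourier_of_integrable hg').locallyIntegrable hg.locallyIntegrable ?_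
  intro φ hφ hφc
  have hc : HasCompactSupport (fun x => (φ x : ℂ)) := hφc.comp_left Complex.ofReal_zero
  have hd : ContDiff ℝ (⊤ : ℕ∞) (fun x => (φ x : ℂ)) := Complex.ofRealCLM.contDiff.comp hφ
  let ψ : SchwartzMap ℝ ℂ := hc.toSchwartzMap hd
  have hψ : ∀ x, ψ x = (φ x : ℂ) := fun x => rfl
  have hinv : 𝓕⁻ (𝓕 (ψ : ℝ → ℂ)) = ψ := by
    rw [← SchwartzMap.fourier_coe, ← SchwartzMap.fourierInv_coe,
      FourierTransform.fourierInv_fourier_eq]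
  calc ∫ x, φ x • 𝓕 (𝓕⁻ g) x = ∫ x, 𝓕 (𝓕⁻ g) x * ψ x := by
        simp [hψ, mul_comm]
    _ = ∫ x, 𝓕⁻ g x * 𝓕 (ψ : ℝ → ℂ) x :=
        Real.integral_fourier_mul_eq_of_integrable hg' ψ.integrable
    _ = ∫ x, g x * 𝓕⁻ (𝓕 (ψ : ℝ → ℂ)) x := by
        refine Real.integral_fourierInv_mul_eq_of_integrable hg ?_
        rw [← SchwartzMap.fourier_coe]
        exact (𝓕 ψ).integrable
    _ = ∫ x, φ x • g x := by
        rw [hinv]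
        simp [hψ, mul_comm]

/-- The function `𝓕 (𝓕⁻ g)` either vanishes or agrees with `g` almost everywhere. -/
theorem Real.enorm_fourier_fourierInv_ae_le (g : ℝ → ℂ) :
    ∀ᵐ ξ, ‖𝓕 (𝓕⁻ g) ξ‖ₑ ≤ ‖g ξ‖ₑ := by
  by_cases hg' : Integrable (𝓕⁻ g)
  · by_cases hg : Integrable g
    · filter_upwards [Real.fourier_fourierInv_ae_eq hg hg'] with ξ hξ
      rw [hξ]
    · refine Filter.Eventually.of_forall fun ξ => ?_
      have h0 : 𝓕⁻ g = 0 := by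
        ext w
        rw [Real.fourierInv_eq_fourier_neg, Real.fourier_eq_zero_of_not_integrable hg]
        rfl
      rw [h0, Real.fourier_eq]
      simp
  · refine Filter.Eventually.of_forall fun ξ => ?_
    rw [Real.fourier_eq_zero_of_not_integrable hg']
    simp

theorem jb_eq_sqrt (x : ℝ) : jb x = √(1 + x ^ 2) := (Real.sqrt_eq_rpow _).symm

theorem jb_sq (x : ℝ) : jb x ^ 2 = 1 + x ^ 2 := by
  rw [jb_eq_sqrt, Real.sq_sqrt (by positivity)]

theorem one_le_jb (x : ℝ) : 1 ≤ jb x := by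
  rw [jb_eq_sqrt, Real.one_le_sqrt]
  nlinarith [sq_nonneg x]

theorem jb_pos (x : ℝ) : 0 < jb x := zero_lt_one.trans_le (one_le_jb x)

theorem abs_le_jb (x : ℝ) : |x| ≤ jb x := by
  rw [jb_eq_sqrt]
  exact Real.abs_le_sqrt (by linarith)

theorem measurable_jb : Measurable jb := by
  unfold jb
  fun_prop

theorem jb_le_jb_add_abs_sub (x y : ℝ) : jb x ≤ jb y + |x - y| := by
  refine le_of_sq_le_sq ?_ (add_nonneg (jb_pos y).le (abs_nonneg _))
  have h : y * (x - y) ≤ jb y * |x - y| :=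
    (le_abs_self _).trans (by rw [abs_mul]; gcongr; exact abs_le_jb y)
  nlinarith [jb_sq x, jb_sq y, sq_abs (x - y)]

theorem jb_sub_add_le (x y z : ℝ) : jb (x - y + z) ≤ jb x + jb y + jb z := by
  have h := jb_le_jb_add_abs_sub (x - y + z) x
  have h1 : |x - y + z - x| ≤ |z| + |y| := by
    rw [show x - y + z - x = z - y by ring]
    exact abs_sub _ _
  linarith [abs_le_jb z, abs_le_jb y]

theorem rpow_abs_le_jb {θ : ℝ} (hθ0 : 0 ≤ θ) (hθ1 : θ ≤ 1) (t : ℝ) : |t| ^ θ ≤ jb t := by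
  rcases le_total |t| 1 with h | h
  · exact (Real.rpow_le_one (abs_nonneg _) h hθ0).trans (one_le_jb t)
  · calc |t| ^ θ ≤ |t| ^ (1 : ℝ) := Real.rpow_le_rpow_of_exponent_le h hθ1
      _ = |t| := Real.rpow_one _
      _ ≤ jb t := abs_le_jb t

theorem modPhi_sub_add (x y z : ℝ) :
    modPhi (x - y + z) x y z = 2 * (x - y) * (z - y) := by
  unfold modPhi
  ring

/-- A majorant, in one of the variables `x` or `z`, of the factor `y ^ 2 / jb (Φ)`. -/
noncomputable def modFactor (θ y x : ℝ) : ℝ :=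
  2 + if |x - y| ≤ jb y / 2 then jb y ^ (2 - θ) * |x - y| ^ (-θ) else 0

/-- The off-diagonal part of the resonance kernel: a Bessel-type weight and a singular part
concentrated at scale `jb c` around `c`. -/
noncomputable def resWeight (s θ c x : ℝ) : ℝ :=
  jb x ^ (-(2 * s)) + if |x - c| ≤ jb c then jb c ^ (θ - 1) * |x - c| ^ (-θ) else 0

theorem resWeight_pos (s θ c x : ℝ) : 0 < resWeight s θ c x := by
  have := jb_pos x
  have := jb_pos c
  unfold resWeight
  split_ifs <;> positivity

theorem two_le_modFactor (θ y x : ℝ) : 2 ≤ modFactor θ y x := by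
  have := jb_pos y
  unfold modFactor
  split_ifs
  · exact le_add_of_nonneg_right (by positivity)
  · simp

theorem sq_div_jb_le_modFactor_mul {θ : ℝ} (hθ0 : 0 ≤ θ) (hθ1 : θ ≤ 1) {x y z : ℝ}
    (hx : x ≠ y) (hz : z ≠ y) :
    y ^ 2 / jb (2 * (x - y) * (z - y)) ≤ modFactor θ y x * modFactor θ y z := by
  have hM1 : 1 ≤ jb y := one_le_jb y
  have hM := jb_pos y
  have hyM : y ^ 2 ≤ jb y ^ 2 := by rw [jb_sq]; linarith
  have ha : 0 < |x - y| := abs_pos.2 (sub_ne_zero.2 hx)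
  have hb : 0 < |z - y| := abs_pos.2 (sub_ne_zero.2 hz)
  set J := jb (2 * (x - y) * (z - y)) with hJ
  have hJ1 : 2 * |x - y| * |z - y| ≤ J := by
    have := abs_le_jb (2 * (x - y) * (z - y))
    rwa [abs_mul, abs_mul, abs_two] at this
  have hJθ : (2 * |x - y| * |z - y|) ^ θ ≤ J := by
    have := rpow_abs_le_jb hθ0 hθ1 (2 * (x - y) * (z - y))
    rwa [abs_mul, abs_mul, abs_two] at this
  have hJ0 : 0 < J := jb_pos _
  rw [div_le_iff₀ hJ0]
  refine hyM.trans ?_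
  clear_value J
  have hx2 := two_le_modFactor θ y x
  have hz2 := two_le_modFactor θ y z
  set M := jb y with hMdef
  set a := |x - y|
  set b := |z - y|
  have hM2 : M ^ 2 = M ^ (2 - θ) * M ^ θ := by
    rw [← Real.rpow_add hM, sub_add_cancel]
    norm_cast
  have haθ : a ^ (-θ) * a ^ θ = 1 := by rw [← Real.rpow_add ha]; simp
  have hbθ : b ^ (-θ) * b ^ θ = 1 := by rw [← Real.rpow_add hb]; simp
  have key : ∀ u v : ℝ, 0 < u → M / 2 ≤ v → u ^ (-θ) * u ^ θ = 1 →
      (2 * u * v) ^ θ ≤ J → M ^ 2 ≤ M ^ (2 - θ) * u ^ (-θ) * J := by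
    intro u v hu hv h1 h2
    calc M ^ 2 = M ^ (2 - θ) * M ^ θ * (u ^ (-θ) * u ^ θ) := by rw [h1, mul_one, hM2]
      _ = M ^ (2 - θ) * u ^ (-θ) * (u * M) ^ θ := by rw [Real.mul_rpow hu.le hM.le]; ring
      _ ≤ M ^ (2 - θ) * u ^ (-θ) * (2 * u * v) ^ θ := by
        have h3 : u * M ≤ 2 * u * v := by nlinarith
        gcongr ?_ * ?_
        exact Real.rpow_le_rpow (by positivity) h3 hθ0
      _ ≤ _ := by gcongr
  by_cases h1 : a ≤ M / 2 <;> by_cases h2 : b ≤ M / 2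
  · have e1 : modFactor θ y x = 2 + M ^ (2 - θ) * a ^ (-θ) := by
      rw [modFactor, if_pos h1]
    have e2 : modFactor θ y z = 2 + M ^ (2 - θ) * b ^ (-θ) := by
      rw [modFactor, if_pos h2]
    have hMge : M ≤ M ^ (2 - θ) := by
      conv_lhs => rw [← Real.rpow_one M]
      exact Real.rpow_le_rpow_of_exponent_le hM1 (by linarith)
    calc M ^ 2 = M * M * (a ^ (-θ) * a ^ θ) * (b ^ (-θ) * b ^ θ) := by rw [haθ, hbθ]; ring
      _ ≤ M ^ (2 - θ) * M ^ (2 - θ) * (a ^ (-θ) * a ^ θ) * (b ^ (-θ) * b ^ θ) := by gcongr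
      _ = (M ^ (2 - θ) * a ^ (-θ)) * (M ^ (2 - θ) * b ^ (-θ)) * (a * b) ^ θ := by
        rw [Real.mul_rpow ha.le hb.le]; ring
      _ ≤ (M ^ (2 - θ) * a ^ (-θ)) * (M ^ (2 - θ) * b ^ (-θ)) * (2 * a * b) ^ θ := by
        gcongr
        linarith
      _ ≤ modFactor θ y x * modFactor θ y z * J := by
        gcongr
        · linarith
        · linarith
  · have e1 : modFactor θ y x = 2 + M ^ (2 - θ) * a ^ (-θ) := by
      rw [modFactor, if_pos h1]
    calc M ^ 2 ≤ M ^ (2 - θ) * a ^ (-θ) * J := key a b ha (not_le.1 h2).le haθ hJθ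
      _ ≤ modFactor θ y x * J := by gcongr; linarith
      _ ≤ modFactor θ y x * modFactor θ y z * J := by
        gcongr
        exact le_mul_of_one_le_right (by linarith) (by linarith)
  · have e2 : modFactor θ y z = 2 + M ^ (2 - θ) * b ^ (-θ) := by
      rw [modFactor, if_pos h2]
    calc M ^ 2 ≤ M ^ (2 - θ) * b ^ (-θ) * J :=
          key b a hb (not_le.1 h1).le hbθ (by rwa [mul_right_comm])
      _ ≤ modFactor θ y z * J := by gcongr; linarith
      _ ≤ modFactor θ y x * modFactor θ y z * J := by
        gcongr
        exact le_mul_of_one_le_left (by linarith) (by linarith)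
  · have h3 : M ^ 2 ≤ 4 * (a * b) := by nlinarith
    have h4 : 4 * J ≤ modFactor θ y x * modFactor θ y z * J := by
      gcongr
      nlinarith
    nlinarith

theorem jb_rpow_weight_le {s θ : ℝ} (hθ : 3 - 2 * s ≤ 2 * θ) (y : ℝ) :
    jb y ^ (2 - θ) * jb y ^ (-(2 * s)) ≤ jb y ^ (θ - 1) := by
  rw [← Real.rpow_add (jb_pos y)]
  exact Real.rpow_le_rpow_of_exponent_le (one_le_jb y) (by linarith)

theorem modFactor_mul_rpow_le_resWeight {s θ : ℝ} (hs : 0 ≤ s) (hθ : 3 - 2 * s ≤ 2 * θ)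
    (y x : ℝ) :
    modFactor θ y x * jb x ^ (-(2 * s)) ≤ (2 + 2 ^ (2 * s)) * resWeight s θ y x := by
  have hy := jb_pos y
  have hx := jb_pos x
  have hp : (0 : ℝ) < 2 ^ (2 * s) := by positivity
  have hw : 0 < jb x ^ (-(2 * s)) := by positivity
  unfold modFactor resWeight
  by_cases h : |x - y| ≤ jb y / 2
  · have hyx : jb y / 2 ≤ jb x := by
      have := jb_le_jb_add_abs_sub y x
      rw [abs_sub_comm] at this
      linarith
    have hxw : jb x ^ (-(2 * s)) ≤ 2 ^ (2 * s) * jb y ^ (-(2 * s)) := by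
      calc jb x ^ (-(2 * s)) ≤ (jb y / 2) ^ (-(2 * s)) :=
            Real.rpow_le_rpow_of_nonpos (by positivity) hyx (by linarith)
        _ = 2 ^ (2 * s) * jb y ^ (-(2 * s)) := by
            rw [Real.div_rpow hy.le zero_le_two, Real.rpow_neg zero_le_two, div_inv_eq_mul,
              mul_comm]
    rw [if_pos h, if_pos (by linarith)]
    have hd : 0 ≤ |x - y| ^ (-θ) := by positivity
    have : jb y ^ (2 - θ) * |x - y| ^ (-θ) * jb x ^ (-(2 * s)) ≤
        2 ^ (2 * s) * (jb y ^ (θ - 1) * |x - y| ^ (-θ)) := by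
      calc jb y ^ (2 - θ) * |x - y| ^ (-θ) * jb x ^ (-(2 * s))
          ≤ jb y ^ (2 - θ) * |x - y| ^ (-θ) * (2 ^ (2 * s) * jb y ^ (-(2 * s))) := by gcongr
        _ = 2 ^ (2 * s) * ((jb y ^ (2 - θ) * jb y ^ (-(2 * s))) * |x - y| ^ (-θ)) := by ring
        _ ≤ _ := by
          gcongr
          exact jb_rpow_weight_le hθ y
    have h2 : 0 ≤ jb y ^ (θ - 1) * |x - y| ^ (-θ) := by positivity
    nlinarith
  · rw [if_neg h]
    have : 0 ≤ if |x - y| ≤ jb y then jb y ^ (θ - 1) * |x - y| ^ (-θ) else 0 := by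
      split_ifs <;> positivity
    nlinarith

theorem modFactor_mul_rpow_le_resWeight_swap {s θ : ℝ} (hθ0 : 0 ≤ θ) (hθ1 : θ ≤ 1)
    (hθ : 3 - 2 * s ≤ 2 * θ) (y x : ℝ) :
    modFactor θ y x * jb y ^ (-(2 * s)) ≤ (2 + 2 ^ (2 * s)) * resWeight s θ x y := by
  have hy := jb_pos y
  have hx := jb_pos x
  have hp : (1 : ℝ) ≤ 2 ^ (2 * s) := Real.one_le_rpow one_le_two (by linarith)
  have hw : 0 < jb y ^ (-(2 * s)) := by positivity
  unfold modFactor resWeight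
  rw [abs_sub_comm y x]
  by_cases h : |x - y| ≤ jb y / 2
  · have hyx : jb y / 2 ≤ jb x := by
      have := jb_le_jb_add_abs_sub y x
      rw [abs_sub_comm] at this
      linarith
    have hxy : jb x / 2 ≤ jb y := by
      have := jb_le_jb_add_abs_sub x y
      linarith
    have hyw : jb y ^ (θ - 1) ≤ 2 * jb x ^ (θ - 1) := by
      calc jb y ^ (θ - 1) ≤ (jb x / 2) ^ (θ - 1) :=
            Real.rpow_le_rpow_of_nonpos (by positivity) hxy (by linarith)
        _ = 2 ^ (1 - θ) * jb x ^ (θ - 1) := by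
            rw [Real.div_rpow hx.le zero_le_two, ← neg_sub 1 θ, Real.rpow_neg zero_le_two,
              div_inv_eq_mul, mul_comm]
        _ ≤ 2 ^ (1 : ℝ) * jb x ^ (θ - 1) := by
            gcongr
            · norm_num
            · linarith
        _ = 2 * jb x ^ (θ - 1) := by rw [Real.rpow_one]
    rw [if_pos h, if_pos (by linarith)]
    have : jb y ^ (2 - θ) * |x - y| ^ (-θ) * jb y ^ (-(2 * s)) ≤
        2 * (jb x ^ (θ - 1) * |x - y| ^ (-θ)) := by
      calc jb y ^ (2 - θ) * |x - y| ^ (-θ) * jb y ^ (-(2 * s))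
          = (jb y ^ (2 - θ) * jb y ^ (-(2 * s))) * |x - y| ^ (-θ) := by ring
        _ ≤ (2 * jb x ^ (θ - 1)) * |x - y| ^ (-θ) := by
          exact mul_le_mul_of_nonneg_right ((jb_rpow_weight_le hθ y).trans hyw) (by positivity)
        _ = _ := by ring
    have h2 : 0 ≤ jb x ^ (θ - 1) * |x - y| ^ (-θ) := by positivity
    nlinarith
  · rw [if_neg h]
    have : 0 ≤ if |x - y| ≤ jb x then jb x ^ (θ - 1) * |x - y| ^ (-θ) else 0 := by
      split_ifs <;> positivity
    nlinarith

open scoped ENNReal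

/-- The resonance kernel: `resWeight` off the diagonal, `∞` on the diagonal. -/
noncomputable def resKernel (s θ c x : ℝ) : ℝ≥0∞ :=
  if x = c then ⊤ else ENNReal.ofReal (resWeight s θ c x)

theorem resKernel_ne_zero (s θ c x : ℝ) : resKernel s θ c x ≠ 0 := by
  unfold resKernel
  split_ifs
  · simp
  · simpa using resWeight_pos s θ c x

theorem measurable_resKernel (s θ : ℝ) :
    Measurable fun p : ℝ × ℝ => resKernel s θ p.1 p.2 := by
  have hj := measurable_jb
  unfold resKernel resWeight
  refine Measurable.ite (measurableSet_eq_fun measurable_snd measurable_fst)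
    measurable_const (Measurable.ennreal_ofReal (Measurable.add (by fun_prop) ?_))
  exact Measurable.ite (measurableSet_le (by fun_prop) (by fun_prop)) (by fun_prop) (by fun_prop)

theorem lintegral_Ioc_rpow_neg {θ R : ℝ} (hθ1 : θ < 1) (hR : 0 < R) :
    ∫⁻ u in Set.Ioc 0 R, ENNReal.ofReal (R ^ (θ - 1) * u ^ (-θ)) =
      ENNReal.ofReal (1 / (1 - θ)) := by
  have hi : IntervalIntegrable (fun u : ℝ => R ^ (θ - 1) * u ^ (-θ)) volume 0 R :=
    (intervalIntegral.intervalIntegrable_rpow' (by linarith)).const_mul _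
  rw [← ofReal_integral_eq_lintegral_ofReal ((intervalIntegrable_iff_integrableOn_Ioc_of_le
    hR.le).1 hi)]
  · rw [← intervalIntegral.integral_of_le hR.le, intervalIntegral.integral_const_mul,
      integral_rpow (Or.inl (by linarith)), Real.zero_rpow (by linarith)]
    congr 1
    have h : R ^ (θ - 1) * R ^ (-θ + 1) = 1 := by
      rw [← Real.rpow_add hR]
      simp
    rw [sub_zero, mul_div_assoc', h]
    ring
  · filter_upwards [ae_restrict_mem measurableSet_Ioc] with u hu
    have := hu.1
    simp only [Pi.zero_apply]
    positivity

theorem lintegral_abs_le_rpow_neg_le {θ R : ℝ} (hθ0 : 0 < θ) (hθ1 : θ < 1) (hR : 0 < R) :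
    ∫⁻ u : ℝ, ENNReal.ofReal (if |u| ≤ R then R ^ (θ - 1) * |u| ^ (-θ) else 0) ≤
      2 * ENNReal.ofReal (1 / (1 - θ)) := by
  set f : ℝ → ℝ≥0∞ :=
    (Set.Ioc 0 R).indicator fun u => ENNReal.ofReal (R ^ (θ - 1) * u ^ (-θ)) with hf
  have hfm : Measurable f := Measurable.indicator (by fun_prop) measurableSet_Ioc
  have hfi : ∫⁻ u, f u = ENNReal.ofReal (1 / (1 - θ)) := by
    rw [hf, lintegral_indicator measurableSet_Ioc, lintegral_Ioc_rpow_neg hθ1 hR]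
  calc ∫⁻ u : ℝ, ENNReal.ofReal (if |u| ≤ R then R ^ (θ - 1) * |u| ^ (-θ) else 0)
      ≤ ∫⁻ u, (f u + f (-u)) := by
        refine lintegral_mono fun u => ?_
        by_cases hu : |u| ≤ R
        · rw [if_pos hu]
          rcases lt_trichotomy u 0 with h | rfl | h
          · rw [abs_of_neg h] at hu ⊢
            refine le_add_left ?_
            rw [hf, Set.indicator_of_mem (show -u ∈ Set.Ioc 0 R from ⟨by linarith, hu⟩)]
          · simp [Real.zero_rpow (neg_ne_zero.2 hθ0.ne')]
          · rw [abs_of_pos h] at hu ⊢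
            refine le_add_right ?_
            rw [hf, Set.indicator_of_mem (show u ∈ Set.Ioc 0 R from ⟨h, hu⟩)]
        · simp [hu]
    _ = 2 * ENNReal.ofReal (1 / (1 - θ)) := by
        rw [lintegral_add_left hfm,
          (Measure.measurePreserving_neg (volume : Measure ℝ)).lintegral_comp hfm, hfi, two_mul]

theorem lintegral_jb_rpow_lt_top {s : ℝ} (hs : 1 / 2 < s) :
    ∫⁻ x, ENNReal.ofReal (jb x ^ (-(2 * s))) < ⊤ := by
  have h := integrable_rpow_neg_one_add_norm_sq (E := ℝ) (μ := volume) (r := 2 * s)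
    (by simp; linarith)
  refine (h.congr (Filter.Eventually.of_forall fun x => ?_)).lintegral_lt_top
  simp only [jb, Real.norm_eq_abs, sq_abs]
  rw [← Real.rpow_mul (by positivity)]
  congr 1
  ring

theorem exists_lintegral_resKernel_le {s θ : ℝ} (hs : 1 / 2 < s) (hθ0 : 0 < θ) (hθ1 : θ < 1) :
    ∃ A : ℝ≥0∞, A ≠ ⊤ ∧ ∀ c, ∫⁻ x, resKernel s θ c x ≤ A := by
  refine ⟨(∫⁻ x, ENNReal.ofReal (jb x ^ (-(2 * s)))) + 2 * ENNReal.ofReal (1 / (1 - θ)),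
    ENNReal.add_ne_top.2 ⟨(lintegral_jb_rpow_lt_top hs).ne,
      ENNReal.mul_ne_top (by simp) ENNReal.ofReal_ne_top⟩, fun c => ?_⟩
  have hj := measurable_jb
  have hae : ∀ᵐ x : ℝ, x ≠ c := by simp [ae_iff]
  calc ∫⁻ x, resKernel s θ c x
      = ∫⁻ x, (ENNReal.ofReal (jb x ^ (-(2 * s))) + ENNReal.ofReal
          (if |x - c| ≤ jb c then jb c ^ (θ - 1) * |x - c| ^ (-θ) else 0)) := by
        refine lintegral_congr_ae ?_
        filter_upwards [hae] with x hx
        have := jb_pos x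
        have := jb_pos c
        rw [resKernel, if_neg hx, resWeight, ENNReal.ofReal_add (by positivity)]
        split_ifs <;> positivity
    _ = (∫⁻ x, ENNReal.ofReal (jb x ^ (-(2 * s)))) + ∫⁻ x, ENNReal.ofReal
          (if |x - c| ≤ jb c then jb c ^ (θ - 1) * |x - c| ^ (-θ) else 0) :=
        lintegral_add_left (by fun_prop) _
    _ ≤ _ := by
        gcongr
        rw [lintegral_sub_right_eq_self (fun u => ENNReal.ofReal
          (if |u| ≤ jb c then jb c ^ (θ - 1) * |u| ^ (-θ) else 0)) c]
        exact lintegral_abs_le_rpow_neg_le hθ0 hθ1 (jb_pos c)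

theorem ofReal_le_mul_resKernel_mul {s θ C r : ℝ} {c x d z : ℝ} (hC : 0 < C)
    (h : x ≠ c → z ≠ d → r ≤ C * (resWeight s θ c x * resWeight s θ d z)) :
    ENNReal.ofReal r ≤ ENNReal.ofReal C * (resKernel s θ c x * resKernel s θ d z) := by
  have hC' : ENNReal.ofReal C ≠ 0 := by simpa using hC
  by_cases hx : x = c
  · rw [resKernel, if_pos hx, ENNReal.top_mul (resKernel_ne_zero _ _ _ _), ENNReal.mul_top hC']
    exact le_top
  by_cases hz : z = d
  · rw [mul_comm (resKernel s θ c x), resKernel, if_pos hz,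
      ENNReal.top_mul (resKernel_ne_zero _ _ _ _), ENNReal.mul_top hC']
    exact le_top
  rw [resKernel, resKernel, if_neg hx, if_neg hz, ← ENNReal.ofReal_mul (resWeight_pos _ _ _ _).le,
    ← ENNReal.ofReal_mul hC.le]
  exact ENNReal.ofReal_le_ofReal (h hx hz)

/-- The multiplier of the trilinear operator, as a function of the three input frequencies. -/
noncomputable def triKernel (x y z : ℝ) : ℝ≥0∞ :=
  ENNReal.ofReal (|y| / jb (modPhi (x - y + z) x y z) ^ ((1 : ℝ) / 2))

/-- The Sobolev weight `⟨x⟩^{-s}`. -/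
noncomputable def sobWeight (s x : ℝ) : ℝ≥0∞ := ENNReal.ofReal (jb x ^ (-s))

theorem measurable_sobWeight (s : ℝ) : Measurable (sobWeight s) := by
  have := measurable_jb
  unfold sobWeight
  fun_prop

theorem measurable_triKernel :
    Measurable fun p : ℝ × ℝ × ℝ => triKernel p.1 p.2.1 p.2.2 := by
  have := measurable_jb
  unfold triKernel modPhi
  fun_prop

theorem triKernel_mul_sobWeight_sq (s x y z u v : ℝ) :
    (triKernel x y z * (sobWeight s u * sobWeight s v)) ^ 2 = ENNReal.ofReal
      (y ^ 2 / jb (2 * (x - y) * (z - y)) * (jb u ^ (-(2 * s)) * jb v ^ (-(2 * s)))) := by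
  have hu := jb_pos u
  have hv := jb_pos v
  have hJ := jb_pos (2 * (x - y) * (z - y))
  have hw : ∀ t, (jb t ^ (-s)) ^ 2 = jb t ^ (-(2 * s)) := fun t => by
    rw [← Real.rpow_natCast, ← Real.rpow_mul (jb_pos t).le]
    congr 1
    push_cast
    ring
  have hJ2 : (jb (2 * (x - y) * (z - y)) ^ ((1 : ℝ) / 2)) ^ 2 = jb (2 * (x - y) * (z - y)) := by
    rw [← Real.rpow_natCast, ← Real.rpow_mul hJ.le]
    norm_num
  rw [triKernel, sobWeight, sobWeight, modPhi_sub_add, ← ENNReal.ofReal_mul (by positivity),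
    ← ENNReal.ofReal_mul (by positivity), ← ENNReal.ofReal_pow (by positivity)]
  congr 1
  rw [mul_pow, mul_pow, div_pow, hw, hw, hJ2, sq_abs]

theorem triKernel_sq_le_outer {s θ : ℝ} (hθ0 : 0 ≤ θ) (hθ1 : θ ≤ 1)
    (hθ : 3 - 2 * s ≤ 2 * θ) (x y z : ℝ) :
    (triKernel x y z * (sobWeight s x * sobWeight s z)) ^ 2 ≤
      ENNReal.ofReal ((2 + 2 ^ (2 * s)) ^ 2) * (resKernel s θ y x * resKernel s θ y z) := by
  rw [triKernel_mul_sobWeight_sq]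
  refine ofReal_le_mul_resKernel_mul (by positivity) fun hx hz => ?_
  have hx' := jb_pos x
  have hz' := jb_pos z
  have h2 := two_le_modFactor θ y x
  have h3 := two_le_modFactor θ y z
  calc _ ≤ modFactor θ y x * modFactor θ y z * (jb x ^ (-(2 * s)) * jb z ^ (-(2 * s))) := by
        gcongr
        exact sq_div_jb_le_modFactor_mul hθ0 hθ1 hx hz
    _ = (modFactor θ y x * jb x ^ (-(2 * s))) * (modFactor θ y z * jb z ^ (-(2 * s))) := by ring
    _ ≤ ((2 + 2 ^ (2 * s)) * resWeight s θ y x) * ((2 + 2 ^ (2 * s)) * resWeight s θ y z) := by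
        have := resWeight_pos s θ y x
        exact mul_le_mul (modFactor_mul_rpow_le_resWeight (by linarith) hθ y x)
          (modFactor_mul_rpow_le_resWeight (by linarith) hθ y z) (by positivity) (by positivity)
    _ = _ := by ring

theorem triKernel_sq_le_left {s θ : ℝ} (hθ0 : 0 ≤ θ) (hθ1 : θ ≤ 1)
    (hθ : 3 - 2 * s ≤ 2 * θ) (x y z : ℝ) :
    (triKernel x y z * (sobWeight s x * sobWeight s y)) ^ 2 ≤
      ENNReal.ofReal ((2 + 2 ^ (2 * s)) ^ 2) * (resKernel s θ y x * resKernel s θ z y) := by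
  rw [triKernel_mul_sobWeight_sq]
  refine ofReal_le_mul_resKernel_mul (by positivity) fun hx hz => ?_
  have hx' := jb_pos x
  have hy' := jb_pos y
  have h2 := two_le_modFactor θ y x
  have h3 := two_le_modFactor θ y z
  calc _ ≤ modFactor θ y x * modFactor θ y z * (jb x ^ (-(2 * s)) * jb y ^ (-(2 * s))) := by
        gcongr
        exact sq_div_jb_le_modFactor_mul hθ0 hθ1 hx hz.symm
    _ = (modFactor θ y x * jb x ^ (-(2 * s))) * (modFactor θ y z * jb y ^ (-(2 * s))) := by ring
    _ ≤ ((2 + 2 ^ (2 * s)) * resWeight s θ y x) * ((2 + 2 ^ (2 * s)) * resWeight s θ z y) := by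
        have := resWeight_pos s θ y x
        exact mul_le_mul (modFactor_mul_rpow_le_resWeight (by linarith) hθ y x)
          (modFactor_mul_rpow_le_resWeight_swap hθ0 hθ1 hθ y z) (by positivity) (by positivity)
    _ = _ := by ring

theorem triKernel_sq_le_right {s θ : ℝ} (hθ0 : 0 ≤ θ) (hθ1 : θ ≤ 1)
    (hθ : 3 - 2 * s ≤ 2 * θ) (x y z : ℝ) :
    (triKernel x y z * (sobWeight s y * sobWeight s z)) ^ 2 ≤
      ENNReal.ofReal ((2 + 2 ^ (2 * s)) ^ 2) * (resKernel s θ y z * resKernel s θ x y) := by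
  have hsymm : triKernel x y z = triKernel z y x := by
    rw [triKernel, triKernel, modPhi_sub_add, modPhi_sub_add, mul_right_comm]
  rw [hsymm, mul_comm (sobWeight s y)]
  exact triKernel_sq_le_left hθ0 hθ1 hθ z y x

theorem sq_lintegral_lintegral_mul_le {f g : ℝ → ℝ → ℝ≥0∞}
    (hf : Measurable fun p : ℝ × ℝ => f p.1 p.2) (hg : Measurable fun p : ℝ × ℝ => g p.1 p.2) :
    (∫⁻ x, ∫⁻ y, f x y * g x y) ^ 2 ≤
      (∫⁻ x, ∫⁻ y, f x y ^ 2) * ∫⁻ x, ∫⁻ y, g x y ^ 2 := by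
  have h := ENNReal.lintegral_mul_le_Lp_mul_Lq ((volume : Measure ℝ).prod (volume : Measure ℝ))
    Real.HolderConjugate.two_two hf.aemeasurable hg.aemeasurable
  simp only [Pi.mul_apply, ENNReal.rpow_two] at h
  rw [lintegral_prod _ (by fun_prop), lintegral_prod _ (by fun_prop),
    lintegral_prod _ (by fun_prop)] at h
  have hr : ∀ a : ℝ≥0∞, (a ^ ((1 : ℝ) / 2)) ^ 2 = a := fun a => by
    rw [← ENNReal.rpow_two, ← ENNReal.rpow_mul]
    norm_num
  calc _ ≤ _ := pow_le_pow_left' h 2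
    _ = _ := by rw [mul_pow, hr, hr]

/-- Cauchy–Schwarz for trilinear expressions on the hyperplane `ξ = x - y + z`. -/
theorem lintegral_sq_hyperplane_le {U V : ℝ → ℝ → ℝ → ℝ≥0∞} {B : ℝ≥0∞}
    (hU : Measurable fun p : ℝ × ℝ × ℝ => U p.1 p.2.1 p.2.2)
    (hV : Measurable fun p : ℝ × ℝ × ℝ => V p.1 p.2.1 p.2.2)
    (hB : ∀ ξ, ∫⁻ x, ∫⁻ y, V x y (ξ - x + y) ^ 2 ≤ B) :
    ∫⁻ ξ, (∫⁻ x, ∫⁻ y, U x y (ξ - x + y) * V x y (ξ - x + y)) ^ 2 ≤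
      (∫⁻ x, ∫⁻ y, ∫⁻ z, U x y z ^ 2) * B := by
  have hsec : ∀ {W : ℝ → ℝ → ℝ → ℝ≥0∞},
      (Measurable fun p : ℝ × ℝ × ℝ => W p.1 p.2.1 p.2.2) →
      ∀ ξ, Measurable fun p : ℝ × ℝ => W p.1 p.2 (ξ - p.1 + p.2) := fun hW ξ =>
    hW.comp (f := fun p : ℝ × ℝ => (p.1, p.2, ξ - p.1 + p.2)) (by fun_prop)
  have hU3 : Measurable fun p : (ℝ × ℝ) × ℝ => U p.1.2 p.2 (p.1.1 - p.1.2 + p.2) ^ 2 :=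
    (hU.comp (f := fun p : (ℝ × ℝ) × ℝ => (p.1.2, p.2, p.1.1 - p.1.2 + p.2))
      (by fun_prop)).pow_const 2
  have hU2 : Measurable fun p : ℝ × ℝ => ∫⁻ y, U p.2 y (p.1 - p.2 + y) ^ 2 :=
    hU3.lintegral_prod_right'
  have hU1 : Measurable fun ξ => ∫⁻ x, ∫⁻ y, U x y (ξ - x + y) ^ 2 :=
    hU2.lintegral_prod_right'
  calc _ ≤ ∫⁻ ξ, (∫⁻ x, ∫⁻ y, U x y (ξ - x + y) ^ 2) * B := by
        refine lintegral_mono fun ξ => ?_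
        exact (sq_lintegral_lintegral_mul_le (hsec hU ξ) (hsec hV ξ)).trans
          (mul_le_mul_right (hB ξ) _)
    _ = (∫⁻ ξ, ∫⁻ x, ∫⁻ y, U x y (ξ - x + y) ^ 2) * B := lintegral_mul_const _ hU1
    _ = (∫⁻ x, ∫⁻ y, ∫⁻ ξ, U x y (ξ - x + y) ^ 2) * B := by
        rw [lintegral_lintegral_swap hU2.aemeasurable]
        congr 2 with x
        refine lintegral_lintegral_swap (Measurable.aemeasurable ?_)
        exact hU3.comp (f := fun p : ℝ × ℝ => ((p.1, x), p.2)) (by fun_prop)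
    _ = (∫⁻ x, ∫⁻ y, ∫⁻ z, U x y z ^ 2) * B := by
        congr 4 with x
        congr 1 with y
        simp_rw [sub_add_eq_add_sub, add_sub_assoc]
        exact lintegral_add_right_eq_self (fun z => U x y z ^ 2) (y - x)

theorem lintegral_lintegral_mul_sq {f g : ℝ → ℝ≥0∞} (hf : Measurable f) (hg : Measurable g) :
    ∫⁻ x, ∫⁻ y, (f x * g y) ^ 2 = (∫⁻ x, f x ^ 2) * ∫⁻ y, g y ^ 2 := by
  simp_rw [mul_pow]
  simp_rw [lintegral_const_mul _ (hg.pow_const 2)]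
  rw [lintegral_mul_const _ (hf.pow_const 2)]

theorem lintegral_sq_mul_le_of_section {N : ℝ → ℝ → ℝ → ℝ≥0∞} {D : ℝ≥0∞} {G : ℝ → ℝ≥0∞}
    (hN : Measurable fun p : ℝ × ℝ × ℝ => N p.1 p.2.1 p.2.2) (hG : Measurable G)
    (hD : ∀ x, ∫⁻ y, ∫⁻ z, N x y z ^ 2 ≤ D) :
    ∫⁻ x, ∫⁻ y, ∫⁻ z, (N x y z * G x) ^ 2 ≤ D * ∫⁻ x, G x ^ 2 := by
  rw [← lintegral_const_mul _ (hG.pow_const 2)]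
  refine lintegral_mono fun x => ?_
  have hN2 : Measurable fun p : ℝ × ℝ => N x p.1 p.2 ^ 2 :=
    (hN.comp (f := fun p : ℝ × ℝ => (x, p.1, p.2)) (by fun_prop)).pow_const 2
  calc ∫⁻ y, ∫⁻ z, (N x y z * G x) ^ 2 = (∫⁻ y, ∫⁻ z, N x y z ^ 2) * G x ^ 2 := by
        rw [← lintegral_mul_const _ hN2.lintegral_prod_right']
        congr 1 with y
        simp_rw [mul_pow]
        exact lintegral_mul_const _ (hN2.comp (f := fun z : ℝ => (y, z)) (by fun_prop))
    _ ≤ D * G x ^ 2 := by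
        gcongr
        exact hD x

theorem lintegral_triple_swap_left {N : ℝ → ℝ → ℝ → ℝ≥0∞}
    (hN : Measurable fun p : ℝ × ℝ × ℝ => N p.1 p.2.1 p.2.2) :
    ∫⁻ x, ∫⁻ y, ∫⁻ z, N x y z = ∫⁻ y, ∫⁻ x, ∫⁻ z, N x y z :=
  lintegral_lintegral_swap (hN.comp (f := fun p : (ℝ × ℝ) × ℝ => (p.1.1, p.1.2, p.2))
    (by fun_prop)).lintegral_prod_right'.aemeasurable

theorem lintegral_triple_swap_right {N : ℝ → ℝ → ℝ → ℝ≥0∞}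
    (hN : Measurable fun p : ℝ × ℝ × ℝ => N p.1 p.2.1 p.2.2) :
    ∫⁻ x, ∫⁻ y, ∫⁻ z, N x y z = ∫⁻ x, ∫⁻ z, ∫⁻ y, N x y z := by
  congr 1 with x
  exact lintegral_lintegral_swap
    (hN.comp (f := fun p : ℝ × ℝ => (x, p.1, p.2)) (by fun_prop)).aemeasurable

section Trilinear

variable {M : ℝ → ℝ → ℝ → ℝ≥0∞} {D : ℝ≥0∞} {F₁ F₂ F₃ : ℝ → ℝ≥0∞}

theorem lintegral_sq_trilinear_le_of_first
    (hM : Measurable fun p : ℝ × ℝ × ℝ => M p.1 p.2.1 p.2.2)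
    (h₁ : Measurable F₁) (h₂ : Measurable F₂) (h₃ : Measurable F₃)
    (hD : ∀ x, ∫⁻ y, ∫⁻ z, M x y z ^ 2 ≤ D) :
    ∫⁻ ξ, (∫⁻ x, ∫⁻ y, M x y (ξ - x + y) * (F₁ x * F₂ y * F₃ (ξ - x + y))) ^ 2 ≤
      D * ((∫⁻ x, F₁ x ^ 2) * (∫⁻ y, F₂ y ^ 2) * ∫⁻ z, F₃ z ^ 2) := by
  have hV : ∀ ξ : ℝ, ∫⁻ x, ∫⁻ y, (F₂ y * F₃ (ξ - x + y)) ^ 2 ≤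
      (∫⁻ y, F₂ y ^ 2) * ∫⁻ z, F₃ z ^ 2 := fun ξ => by
    rw [lintegral_lintegral_swap (Measurable.aemeasurable (by fun_prop)),
      ← lintegral_lintegral_mul_sq h₂ h₃]
    refine le_of_eq ?_
    congr 1 with y
    simp_rw [sub_add_eq_add_sub]
    exact lintegral_sub_left_eq_self (fun z => (F₂ y * F₃ z) ^ 2) (ξ + y)
  calc _ = ∫⁻ ξ, (∫⁻ x, ∫⁻ y, (M x y (ξ - x + y) * F₁ x) * (F₂ y * F₃ (ξ - x + y))) ^ 2 := by
        simp only [mul_assoc]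
    _ ≤ _ := lintegral_sq_hyperplane_le (U := fun x y z => M x y z * F₁ x)
        (V := fun _ y z => F₂ y * F₃ z) (by fun_prop) (by fun_prop) hV
    _ ≤ (D * ∫⁻ x, F₁ x ^ 2) * _ := by
        gcongr
        exact lintegral_sq_mul_le_of_section hM h₁ hD
    _ = _ := by ring

theorem lintegral_sq_trilinear_le_of_second
    (hM : Measurable fun p : ℝ × ℝ × ℝ => M p.1 p.2.1 p.2.2)
    (h₁ : Measurable F₁) (h₂ : Measurable F₂) (h₃ : Measurable F₃)
    (hD : ∀ y, ∫⁻ x, ∫⁻ z, M x y z ^ 2 ≤ D) :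
    ∫⁻ ξ, (∫⁻ x, ∫⁻ y, M x y (ξ - x + y) * (F₁ x * F₂ y * F₃ (ξ - x + y))) ^ 2 ≤
      D * ((∫⁻ x, F₁ x ^ 2) * (∫⁻ y, F₂ y ^ 2) * ∫⁻ z, F₃ z ^ 2) := by
  have hV : ∀ ξ : ℝ, ∫⁻ x, ∫⁻ y, (F₁ x * F₃ (ξ - x + y)) ^ 2 ≤
      (∫⁻ x, F₁ x ^ 2) * ∫⁻ z, F₃ z ^ 2 := fun ξ => by
    rw [← lintegral_lintegral_mul_sq h₁ h₃]
    refine le_of_eq ?_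
    congr 1 with x
    exact lintegral_add_left_eq_self (fun z => (F₁ x * F₃ z) ^ 2) (ξ - x)
  calc _ = ∫⁻ ξ, (∫⁻ x, ∫⁻ y, (M x y (ξ - x + y) * F₂ y) * (F₁ x * F₃ (ξ - x + y))) ^ 2 := by
        simp only [mul_assoc, mul_left_comm]
    _ ≤ _ := lintegral_sq_hyperplane_le (U := fun x y z => M x y z * F₂ y)
        (V := fun x _ z => F₁ x * F₃ z) (by fun_prop) (by fun_prop) hV
    _ ≤ (D * ∫⁻ x, F₂ x ^ 2) * _ := by
        gcongr
        rw [lintegral_triple_swap_left (by fun_prop)]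
        exact lintegral_sq_mul_le_of_section (N := fun y x z => M x y z)
          (hM.comp (f := fun p : ℝ × ℝ × ℝ => (p.2.1, p.1, p.2.2)) (by fun_prop)) h₂ hD
    _ = _ := by ring

theorem lintegral_sq_trilinear_le_of_third
    (hM : Measurable fun p : ℝ × ℝ × ℝ => M p.1 p.2.1 p.2.2)
    (h₁ : Measurable F₁) (h₂ : Measurable F₂) (h₃ : Measurable F₃)
    (hD : ∀ z, ∫⁻ y, ∫⁻ x, M x y z ^ 2 ≤ D) :
    ∫⁻ ξ, (∫⁻ x, ∫⁻ y, M x y (ξ - x + y) * (F₁ x * F₂ y * F₃ (ξ - x + y))) ^ 2 ≤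
      D * ((∫⁻ x, F₁ x ^ 2) * (∫⁻ y, F₂ y ^ 2) * ∫⁻ z, F₃ z ^ 2) := by
  have hM2 : Measurable fun p : ℝ × ℝ × ℝ => (M p.1 p.2.1 p.2.2 * F₃ p.2.2) ^ 2 := by fun_prop
  calc _ = ∫⁻ ξ, (∫⁻ x, ∫⁻ y, (M x y (ξ - x + y) * F₃ (ξ - x + y)) * (F₁ x * F₂ y)) ^ 2 := by
        simp only [mul_comm, mul_left_comm]
    _ ≤ _ := lintegral_sq_hyperplane_le (U := fun x y z => M x y z * F₃ z)
        (V := fun x y _ => F₁ x * F₂ y) (by fun_prop) (by fun_prop)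
        (fun ξ => (lintegral_lintegral_mul_sq h₁ h₂).le)
    _ ≤ (D * ∫⁻ x, F₃ x ^ 2) * _ := by
        gcongr
        rw [lintegral_triple_swap_left hM2,
          lintegral_triple_swap_right (N := fun y x z => (M x y z * F₃ z) ^ 2)
            (hM2.comp (f := fun p : ℝ × ℝ × ℝ => (p.2.1, p.1, p.2.2)) (by fun_prop)),
          lintegral_triple_swap_left (N := fun y z x => (M x y z * F₃ z) ^ 2)
            (hM2.comp (f := fun p : ℝ × ℝ × ℝ => (p.2.2, p.1, p.2.1)) (by fun_prop))]
        exact lintegral_sq_mul_le_of_section (N := fun z y x => M x y z)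
          (hM.comp (f := fun p : ℝ × ℝ × ℝ => (p.2.2, p.2.1, p.1)) (by fun_prop)) h₃ hD
    _ = _ := by ring

end Trilinear

theorem lintegral_resKernel_chain_le {s θ : ℝ} {A : ℝ≥0∞}
    (hA : ∀ c, ∫⁻ x, resKernel s θ c x ≤ A) (C : ℝ≥0∞) (c : ℝ) :
    ∫⁻ y, ∫⁻ x, C * (resKernel s θ y x * resKernel s θ c y) ≤ C * (A * A) := by
  have hE : ∀ c, Measurable (resKernel s θ c) := fun c =>
    (measurable_resKernel s θ).comp (f := fun x => (c, x)) (by fun_prop)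
  calc _ ≤ ∫⁻ y, C * A * resKernel s θ c y := by
        refine lintegral_mono fun y => ?_
        have := hE y
        rw [lintegral_const_mul _ (by fun_prop), lintegral_mul_const _ this, mul_assoc]
        gcongr
        exact hA y
    _ ≤ C * (A * A) := by
        rw [lintegral_const_mul _ (hE c), mul_assoc]
        gcongr
        exact hA c

theorem lintegral_resKernel_prod_le {s θ : ℝ} {A : ℝ≥0∞}
    (hA : ∀ c, ∫⁻ x, resKernel s θ c x ≤ A) (C : ℝ≥0∞) (c : ℝ) :
    ∫⁻ x, ∫⁻ z, C * (resKernel s θ c x * resKernel s θ c z) ≤ C * (A * A) := by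
  have hE : Measurable (resKernel s θ c) :=
    (measurable_resKernel s θ).comp (f := fun x => (c, x)) (by fun_prop)
  calc _ = ∫⁻ x, C * (resKernel s θ c x * ∫⁻ z, resKernel s θ c z) := by
        congr 1 with x
        rw [lintegral_const_mul _ (by fun_prop), lintegral_const_mul _ hE]
    _ = C * ((∫⁻ x, resKernel s θ c x) * ∫⁻ z, resKernel s θ c z) := by
        rw [lintegral_const_mul _ (by fun_prop), lintegral_mul_const _ hE]
    _ ≤ C * (A * A) := by
        gcongr <;> exact hA c

theorem rpow_jb_sub_add_le {s : ℝ} (hs : 0 ≤ s) (x y z : ℝ) :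
    jb (x - y + z) ^ s ≤ 3 ^ s * (jb x ^ s + jb y ^ s + jb z ^ s) := by
  have hx := jb_pos x
  have hy := jb_pos y
  have hz := jb_pos z
  have key : ∀ t, 0 < t → jb x ≤ t → jb y ≤ t → jb z ≤ t →
      jb (x - y + z) ^ s ≤ 3 ^ s * t ^ s := fun t ht h1 h2 h3 => by
    rw [← Real.mul_rpow (by norm_num) ht.le]
    exact Real.rpow_le_rpow (jb_pos _).le (by linarith [jb_sub_add_le x y z]) hs
  have hx' : 0 ≤ jb x ^ s := by positivity
  have hy' : 0 ≤ jb y ^ s := by positivity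
  have hz' : 0 ≤ jb z ^ s := by positivity
  have h3 : (0 : ℝ) < 3 ^ s := by positivity
  rcases le_total (jb x) (jb y) with h | h <;> rcases le_total (jb y) (jb z) with h' | h' <;>
    rcases le_total (jb x) (jb z) with h'' | h''
  all_goals
    first
    | exact (key _ hx le_rfl (by linarith) (by linarith)).trans (by gcongr; linarith)
    | exact (key _ hy (by linarith) le_rfl (by linarith)).trans (by gcongr; linarith)
    | exact (key _ hz (by linarith) (by linarith) le_rfl).trans (by gcongr; linarith)

theorem ofReal_jb_rpow_mul_sobWeight (s x : ℝ) :
    ENNReal.ofReal (jb x ^ s) * sobWeight s x = 1 := by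
  have hx := jb_pos x
  rw [sobWeight, ← ENNReal.ofReal_mul (by positivity), ← Real.rpow_add hx]
  simp

theorem ofReal_jb_rpow_mul_sobWeight_le {s : ℝ} (hs : 0 ≤ s) (x y z : ℝ) :
    ENNReal.ofReal (jb (x - y + z) ^ s) * (sobWeight s x * sobWeight s y * sobWeight s z) ≤
      ENNReal.ofReal (3 ^ s) * (sobWeight s y * sobWeight s z + sobWeight s x * sobWeight s z +
        sobWeight s x * sobWeight s y) := by
  have hx := (jb_pos x).le
  have hy := (jb_pos y).le
  have hz := (jb_pos z).le
  calc _ ≤ ENNReal.ofReal (3 ^ s * (jb x ^ s + jb y ^ s + jb z ^ s)) *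
          (sobWeight s x * sobWeight s y * sobWeight s z) := by
        gcongr
        exact rpow_jb_sub_add_le hs x y z
    _ = ENNReal.ofReal (3 ^ s) * (
          (ENNReal.ofReal (jb x ^ s) * sobWeight s x) * (sobWeight s y * sobWeight s z) +
          (ENNReal.ofReal (jb y ^ s) * sobWeight s y) * (sobWeight s x * sobWeight s z) +
          (ENNReal.ofReal (jb z ^ s) * sobWeight s z) * (sobWeight s x * sobWeight s y)) := by
        rw [ENNReal.ofReal_mul (by positivity), ENNReal.ofReal_add (by positivity) (by positivity),
          ENNReal.ofReal_add (by positivity) (by positivity)]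
        ring
    _ = _ := by simp only [ofReal_jb_rpow_mul_sobWeight, one_mul]

theorem ENNReal.add_add_sq_le (a b c : ℝ≥0∞) :
    (a + b + c) ^ 2 ≤ 9 * (a ^ 2 + b ^ 2 + c ^ 2) := by
  have key : ∀ t, a ≤ t → b ≤ t → c ≤ t → (a + b + c) ^ 2 ≤ 9 * t ^ 2 := fun t h1 h2 h3 => by
    calc (a + b + c) ^ 2 ≤ (t + t + t) ^ 2 := by gcongr
      _ = 9 * t ^ 2 := by ring
  have ha : a ^ 2 ≤ a ^ 2 + b ^ 2 + c ^ 2 := by rw [add_assoc]; exact le_self_add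
  have hb : b ^ 2 ≤ a ^ 2 + b ^ 2 + c ^ 2 := le_add_right le_add_self
  have hc : c ^ 2 ≤ a ^ 2 + b ^ 2 + c ^ 2 := le_add_self
  rcases le_total a b with h | h <;> rcases le_total b c with h' | h'
  · exact (key c (h.trans h') h' le_rfl).trans (by gcongr)
  · exact (key b h le_rfl h').trans (by gcongr)
  · rcases le_total a c with h'' | h''
    · exact (key c h'' h' le_rfl).trans (by gcongr)
    · exact (key a le_rfl h h'').trans (by gcongr)
  · exact (key a le_rfl h (h'.trans h)).trans (by gcongr)

theorem measurable_hyperplane_lintegral {N : ℝ → ℝ → ℝ → ℝ≥0∞}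
    (hN : Measurable fun p : ℝ × ℝ × ℝ => N p.1 p.2.1 p.2.2) :
    Measurable fun ξ => ∫⁻ x, ∫⁻ y, N x y (ξ - x + y) :=
  Measurable.lintegral_prod_right' (f := fun p : ℝ × ℝ => ∫⁻ y, N p.2 y (p.1 - p.2 + y))
    (hN.comp (f := fun p : (ℝ × ℝ) × ℝ => (p.1.2, p.2, p.1.1 - p.1.2 + p.2))
      (by fun_prop)).lintegral_prod_right'

theorem hyperplane_lintegral_add {N N' : ℝ → ℝ → ℝ → ℝ≥0∞}
    (hN : Measurable fun p : ℝ × ℝ × ℝ => N p.1 p.2.1 p.2.2) (ξ : ℝ) :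
    ∫⁻ x, ∫⁻ y, (N x y (ξ - x + y) + N' x y (ξ - x + y)) =
      (∫⁻ x, ∫⁻ y, N x y (ξ - x + y)) + ∫⁻ x, ∫⁻ y, N' x y (ξ - x + y) := by
  have h : Measurable fun p : ℝ × ℝ => N p.1 p.2 (ξ - p.1 + p.2) :=
    hN.comp (f := fun p : ℝ × ℝ => (p.1, p.2, ξ - p.1 + p.2)) (by fun_prop)
  rw [← lintegral_add_left h.lintegral_prod_right']
  congr 1 with x
  exact lintegral_add_left (h.comp (f := fun y : ℝ => (x, y)) (by fun_prop)) _

/-- The trilinear estimate for nonnegative functions on the Fourier side. -/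
theorem exists_lintegral_triKernel_le {s : ℝ} (hs : 1 / 2 < s) :
    ∃ K : ℝ≥0∞, K ≠ ⊤ ∧ ∀ F₁ F₂ F₃ : ℝ → ℝ≥0∞, Measurable F₁ → Measurable F₂ → Measurable F₃ →
      ∫⁻ ξ, (ENNReal.ofReal (jb ξ ^ s) * ∫⁻ x, ∫⁻ y, triKernel x y (ξ - x + y) *
        ((sobWeight s x * F₁ x) * (sobWeight s y * F₂ y) *
          (sobWeight s (ξ - x + y) * F₃ (ξ - x + y)))) ^ 2 ≤
      K * ((∫⁻ x, F₁ x ^ 2) * (∫⁻ y, F₂ y ^ 2) * ∫⁻ z, F₃ z ^ 2) := by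
  obtain ⟨θ, hθ0, hθ1, hθ⟩ : ∃ θ : ℝ, 0 < θ ∧ θ < 1 ∧ 3 - 2 * s ≤ 2 * θ :=
    ⟨max (1 / 2) (3 / 2 - s), lt_max_of_lt_left (by norm_num),
      max_lt (by norm_num) (by linarith), by linarith [le_max_right (1 / 2) (3 / 2 - s)]⟩
  obtain ⟨A, hA, hAE⟩ := exists_lintegral_resKernel_le hs hθ0 hθ1
  set C := ENNReal.ofReal ((2 + 2 ^ (2 * s)) ^ 2) with hC
  set c := ENNReal.ofReal (3 ^ s) with hc
  have hcC : c ^ 2 * 9 * (3 * (C * (A * A))) ≠ ⊤ := by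
    simp only [hC, hc]
    finiteness
  refine ⟨c ^ 2 * 9 * (3 * (C * (A * A))), hcC, fun F₁ F₂ F₃ h₁ h₂ h₃ => ?_⟩
  have hK := measurable_triKernel
  have hW := measurable_sobWeight s
  set M₁ : ℝ → ℝ → ℝ → ℝ≥0∞ := fun x y z => triKernel x y z * (sobWeight s y * sobWeight s z)
    with hM₁
  set M₂ : ℝ → ℝ → ℝ → ℝ≥0∞ := fun x y z => triKernel x y z * (sobWeight s x * sobWeight s z)
    with hM₂
  set M₃ : ℝ → ℝ → ℝ → ℝ≥0∞ := fun x y z => triKernel x y z * (sobWeight s x * sobWeight s y)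
    with hM₃
  have m₁ : Measurable fun p : ℝ × ℝ × ℝ => M₁ p.1 p.2.1 p.2.2 := by fun_prop
  have m₂ : Measurable fun p : ℝ × ℝ × ℝ => M₂ p.1 p.2.1 p.2.2 := by fun_prop
  have m₃ : Measurable fun p : ℝ × ℝ × ℝ => M₃ p.1 p.2.1 p.2.2 := by fun_prop
  let I : (ℝ → ℝ → ℝ → ℝ≥0∞) → ℝ → ℝ≥0∞ := fun M ξ =>
    ∫⁻ x, ∫⁻ y, M x y (ξ - x + y) * (F₁ x * F₂ y * F₃ (ξ - x + y))
  have mI : ∀ M : ℝ → ℝ → ℝ → ℝ≥0∞, (Measurable fun p : ℝ × ℝ × ℝ => M p.1 p.2.1 p.2.2) →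
      Measurable (I M) := fun M hM =>
    measurable_hyperplane_lintegral (N := fun x y z => M x y z * (F₁ x * F₂ y * F₃ z))
      (by fun_prop)
  set P := (∫⁻ x, F₁ x ^ 2) * (∫⁻ y, F₂ y ^ 2) * ∫⁻ z, F₃ z ^ 2 with hP
  have b₁ : ∫⁻ ξ, I M₁ ξ ^ 2 ≤ C * (A * A) * P :=
    lintegral_sq_trilinear_le_of_first m₁ h₁ h₂ h₃ fun x =>
      (lintegral_mono fun y => lintegral_mono fun z =>
        triKernel_sq_le_right hθ0.le hθ1.le hθ x y z).trans
        (lintegral_resKernel_chain_le hAE C x)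
  have b₂ : ∫⁻ ξ, I M₂ ξ ^ 2 ≤ C * (A * A) * P :=
    lintegral_sq_trilinear_le_of_second m₂ h₁ h₂ h₃ fun y =>
      (lintegral_mono fun x => lintegral_mono fun z =>
        triKernel_sq_le_outer hθ0.le hθ1.le hθ x y z).trans
        (lintegral_resKernel_prod_le hAE C y)
  have b₃ : ∫⁻ ξ, I M₃ ξ ^ 2 ≤ C * (A * A) * P :=
    lintegral_sq_trilinear_le_of_third m₃ h₁ h₂ h₃ fun z =>
      (lintegral_mono fun y => lintegral_mono fun x =>
        triKernel_sq_le_left hθ0.le hθ1.le hθ x y z).trans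
        (lintegral_resKernel_chain_le hAE C z)
  have hpt : ∀ ξ, (ENNReal.ofReal (jb ξ ^ s) * ∫⁻ x, ∫⁻ y, triKernel x y (ξ - x + y) *
        ((sobWeight s x * F₁ x) * (sobWeight s y * F₂ y) *
          (sobWeight s (ξ - x + y) * F₃ (ξ - x + y)))) ≤ c * (I M₁ ξ + I M₂ ξ + I M₃ ξ) := by
    intro ξ
    calc _ ≤ ∫⁻ x, ∫⁻ y, ENNReal.ofReal (jb ξ ^ s) * (triKernel x y (ξ - x + y) *
          ((sobWeight s x * F₁ x) * (sobWeight s y * F₂ y) *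
            (sobWeight s (ξ - x + y) * F₃ (ξ - x + y)))) :=
          (lintegral_const_mul_le _ _).trans
            (lintegral_mono fun x => lintegral_const_mul_le _ _)
      _ ≤ ∫⁻ x, ∫⁻ y, c * (M₁ x y (ξ - x + y) * (F₁ x * F₂ y * F₃ (ξ - x + y)) +
            M₂ x y (ξ - x + y) * (F₁ x * F₂ y * F₃ (ξ - x + y)) +
            M₃ x y (ξ - x + y) * (F₁ x * F₂ y * F₃ (ξ - x + y))) := by
          refine lintegral_mono fun x => lintegral_mono fun y => ?_
          have h := ofReal_jb_rpow_mul_sobWeight_le (s := s) (by linarith) x y (ξ - x + y)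
          rw [show x - y + (ξ - x + y) = ξ by ring] at h
          calc _ = (ENNReal.ofReal (jb ξ ^ s) * (sobWeight s x * sobWeight s y *
                sobWeight s (ξ - x + y))) *
                (triKernel x y (ξ - x + y) * (F₁ x * F₂ y * F₃ (ξ - x + y))) := by ring
            _ ≤ _ := mul_le_mul_left h _
            _ = _ := by
                simp only [hM₁, hM₂, hM₃]
                ring
      _ = c * (I M₁ ξ + I M₂ ξ + I M₃ ξ) := by
          simp_rw [lintegral_const_mul' c _ ENNReal.ofReal_ne_top]
          rw [hyperplane_lintegral_add (N := fun x y z => M₁ x y z * (F₁ x * F₂ y * F₃ z) +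
              M₂ x y z * (F₁ x * F₂ y * F₃ z)) (N' := fun x y z => M₃ x y z *
              (F₁ x * F₂ y * F₃ z)) (by fun_prop),
            hyperplane_lintegral_add (N := fun x y z => M₁ x y z * (F₁ x * F₂ y * F₃ z))
              (N' := fun x y z => M₂ x y z * (F₁ x * F₂ y * F₃ z)) (by fun_prop)]
  have mI₁ := mI _ m₁
  have mI₂ := mI _ m₂
  calc _ ≤ ∫⁻ ξ, c ^ 2 * 9 * (I M₁ ξ ^ 2 + I M₂ ξ ^ 2 + I M₃ ξ ^ 2) := by
        refine lintegral_mono fun ξ => (pow_le_pow_left' (hpt ξ) 2).trans ?_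
        rw [mul_pow, mul_assoc]
        gcongr
        exact ENNReal.add_add_sq_le _ _ _
    _ = c ^ 2 * 9 * ((∫⁻ ξ, I M₁ ξ ^ 2) + (∫⁻ ξ, I M₂ ξ ^ 2) + ∫⁻ ξ, I M₃ ξ ^ 2) := by
        rw [lintegral_const_mul' _ _ (by simp only [hc]; finiteness),
          lintegral_add_left (by fun_prop), lintegral_add_left (by fun_prop)]
    _ ≤ c ^ 2 * 9 * (C * (A * A) * P + C * (A * A) * P + C * (A * A) * P) := by gcongr
    _ = _ := by ring

theorem enorm_TPhi_symbol_le (v₁ v₂ v₃ : ℝ → ℂ) (ξ : ℝ) :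
    ‖∫ ξ₁ : ℝ, ∫ ξ₂ : ℝ,
      ((|ξ₂| / jb (modPhi ξ ξ₁ ξ₂ (ξ - ξ₁ + ξ₂)) ^ ((1 : ℝ) / 2) : ℝ) : ℂ) *
        𝓕 v₁ ξ₁ * (starRingEnd ℂ) (𝓕 v₂ ξ₂) * 𝓕 v₃ (ξ - ξ₁ + ξ₂)‖ₑ ≤
      ∫⁻ x, ∫⁻ y, triKernel x y (ξ - x + y) *
        (‖𝓕 v₁ x‖ₑ * ‖𝓕 v₂ y‖ₑ * ‖𝓕 v₃ (ξ - x + y)‖ₑ) := by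
  refine (enorm_integral_le_lintegral_enorm _).trans (lintegral_mono fun x => ?_)
  refine (enorm_integral_le_lintegral_enorm _).trans (lintegral_mono fun y => le_of_eq ?_)
  have hJ := jb_pos (modPhi ξ x y (ξ - x + y))
  rw [enorm_mul, enorm_mul, enorm_mul, RCLike.enorm_conj, triKernel,
    show x - y + (ξ - x + y) = ξ by ring, ← ofReal_norm (Complex.ofReal _),
    Complex.norm_real, Real.norm_of_nonneg (by positivity)]
  ring

/-- The weighted Fourier modulus `⟨x⟩^s |v̂(x)|`. -/
noncomputable def sobProfile (s : ℝ) (v : ℝ → ℂ) (x : ℝ) : ℝ≥0∞ :=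
  ENNReal.ofReal (jb x ^ s) * ‖𝓕 v x‖ₑ

theorem measurable_sobProfile (s : ℝ) (v : ℝ → ℂ) : Measurable (sobProfile s v) := by
  have := measurable_jb
  have := Real.measurable_fourier v
  unfold sobProfile
  fun_prop

theorem sobWeight_mul_sobProfile (s : ℝ) (v : ℝ → ℂ) (x : ℝ) :
    sobWeight s x * sobProfile s v x = ‖𝓕 v x‖ₑ := by
  rw [sobProfile, ← mul_assoc, mul_comm (sobWeight s x), ofReal_jb_rpow_mul_sobWeight, one_mul]

theorem sobProfile_sq (s : ℝ) (v : ℝ → ℂ) (x : ℝ) :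
    sobProfile s v x ^ 2 = ENNReal.ofReal (jb x ^ (2 * s) * ‖𝓕 v x‖ ^ 2) := by
  have hx := jb_pos x
  rw [sobProfile, ← ofReal_norm, ← ENNReal.ofReal_mul (by positivity),
    ← ENNReal.ofReal_pow (by positivity), mul_pow, mul_comm 2 s, Real.rpow_mul hx.le]
  norm_num

theorem sobolevNorm_eq_toReal (s : ℝ) (v : ℝ → ℂ) :
    sobolevNorm s v = (∫⁻ x, sobProfile s v x ^ 2).toReal ^ ((1 : ℝ) / 2) := by
  have hj := measurable_jb
  have hv := Real.measurable_fourier v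
  simp_rw [sobProfile_sq]
  rw [sobolevNorm, integral_eq_lintegral_of_nonneg_ae _ (Measurable.aestronglyMeasurable
    (by fun_prop))]
  exact Filter.Eventually.of_forall fun x => by
    have := jb_pos x
    simp only [Pi.zero_apply]
    positivity

theorem memHs.lintegral_sobProfile_sq_ne_top {s : ℝ} {v : ℝ → ℂ} (h : memHs s v) :
    ∫⁻ x, sobProfile s v x ^ 2 ≠ ⊤ := by
  simp_rw [sobProfile_sq]
  exact h.lintegral_lt_top.ne

/-- The basic trilinear estimate in the `H^s(ℝ)`-norm, `s > 1/2`: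
`‖T_Φ(v₁,v₂,v₃)‖_{H^s} ≤ C(s) ∏_{j=1}^3 ‖v_j‖_{H^s}`. -/
theorem TPhi_estimate (s : ℝ) (hs : 1 / 2 < s) :
    ∃ C : ℝ, 0 < C ∧ ∀ v₁ v₂ v₃ : ℝ → ℂ,
      memHs s v₁ → memHs s v₂ → memHs s v₃ →
      sobolevNorm s (TPhi v₁ v₂ v₃) ≤
        C * (sobolevNorm s v₁ * sobolevNorm s v₂ * sobolevNorm s v₃) := by
  obtain ⟨K, hK, hest⟩ := exists_lintegral_triKernel_le hs
  refine ⟨K.toReal ^ ((1 : ℝ) / 2) + 1, by positivity, fun v₁ v₂ v₃ h₁ h₂ h₃ => ?_⟩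
  have hle : ∫⁻ ξ, sobProfile s (TPhi v₁ v₂ v₃) ξ ^ 2 ≤
      K * ((∫⁻ x, sobProfile s v₁ x ^ 2) * (∫⁻ x, sobProfile s v₂ x ^ 2) *
        ∫⁻ x, sobProfile s v₃ x ^ 2) := by
    refine le_trans (lintegral_mono_ae ?_) (hest _ _ _ (measurable_sobProfile s v₁)
      (measurable_sobProfile s v₂) (measurable_sobProfile s v₃))
    filter_upwards [Real.enorm_fourier_fourierInv_ae_le fun ξ : ℝ => ∫ ξ₁ : ℝ, ∫ ξ₂ : ℝ,
      ((|ξ₂| / jb (modPhi ξ ξ₁ ξ₂ (ξ - ξ₁ + ξ₂)) ^ ((1 : ℝ) / 2) : ℝ) : ℂ) *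
        𝓕 v₁ ξ₁ * (starRingEnd ℂ) (𝓕 v₂ ξ₂) * 𝓕 v₃ (ξ - ξ₁ + ξ₂)] with ξ hξ
    simp only [sobWeight_mul_sobProfile]
    exact pow_le_pow_left' (mul_le_mul_right (hξ.trans (enorm_TPhi_symbol_le v₁ v₂ v₃ ξ)) _) 2
  have hfin := ENNReal.mul_ne_top (ENNReal.mul_ne_top h₁.lintegral_sobProfile_sq_ne_top
    h₂.lintegral_sobProfile_sq_ne_top) h₃.lintegral_sobProfile_sq_ne_top
  have hreal := ENNReal.toReal_mono (ENNReal.mul_ne_top hK hfin) hle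
  simp only [ENNReal.toReal_mul] at hreal
  simp only [sobolevNorm_eq_toReal]
  rw [← Real.mul_rpow (by positivity) (by positivity), ← Real.mul_rpow (by positivity)
    (by positivity)]
  calc _ ≤ _ := Real.rpow_le_rpow (by positivity) hreal (by norm_num)
    _ = _ := Real.mul_rpow (by positivity) (by positivity)
    _ ≤ _ := by
        gcongr
        linarith
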